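/- Let Θ = {x₁,…,x_{n+1}} ⊂ ℝⁿ be affinely independent and let x ∈ ℝⁿ have barycentric coordinates ℓ₁,…,ℓ_{n+1} with respect to Θ, where ℓ₁ > 0 and ℓ_i ≤ 0 for all i = 2,…,n+1. Then: (a) w = (x + Σ_{i=1}^{n+1} |ℓ_i| x_i) / (1 + Σ_{i=1}^{n+1} |ℓ_i|) equals x₁; (b) the bound (ν/2)(‖x − w‖² + Σ_{i=1}^{n+1} |ℓ_i| ‖x_i − w‖²) equals (ν/2)(‖x‖² − Σ_{i=1}^{n+1} ℓ_i ‖x_i‖²); and (c) the function f(u) = −(ν/2)‖u‖² belongs to C¹,¹_ν(ℝⁿ), and its affine interpolant f̂ on Θ satisfies f̂(x) − f(x) = (ν/2)(‖x‖² − Σ_{i=1}^{n+1} ℓ_i ‖x_i‖²), so the bound is attained. -/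

import Mathlib

open Finset in
theorem AffineMap.map_sum_smul_of_sum_eq_one {ι E F : Type*} [Fintype ι]
    [AddCommGroup E] [Module ℝ E] [AddCommGroup F] [Module ℝ F]
    (g : E →ᵃ[ℝ] F) (x : ι → E) (c : ι → ℝ) (hc : ∑ i, c i = 1) :
    g (∑ i, c i • x i) = ∑ i, c i • g (x i) := by
  have hg : ∀ u, g u = g.linear u + g 0 := fun u => congrFun g.decomp u
  have hterm : ∀ i, c i • g (x i) = c i • g.linear (x i) + c i • g 0 := fun i => by
    rw [hg (x i), smul_add]
  simp_rw [hterm, sum_add_distrib, ← sum_smul, hc, one_smul]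
  rw [hg, map_sum]
  simp_rw [map_smul]

theorem abs_smul_eq_of_nonpos_of_ne {ι E : Type*} [DecidableEq ι] [AddCommGroup E] [Module ℝ E]
    (c : ι → ℝ) (j : ι) (hj : 0 < c j) (hneg : ∀ i, i ≠ j → c i ≤ 0) (y : ι → E) (i : ι) :
    |c i| • y i = (if i = j then (2 * c j) • y j else 0) - c i • y i := by
  split_ifs with h
  · subst h
    rw [abs_of_pos hj]
    module
  · rw [abs_of_nonpos (hneg i h)]
    module

theorem sum_mul_norm_sub_sq_of_sum_eq_one {ι E : Type*} [Fintype ι]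
    [NormedAddCommGroup E] [InnerProductSpace ℝ E]
    (c : ι → ℝ) (x : ι → E) (hc : ∑ i, c i = 1) (w : E) :
    ∑ i, c i * ‖x i - w‖ ^ 2
      = ∑ i, c i * ‖x i‖ ^ 2 - 2 * inner ℝ (∑ i, c i • x i) w + ‖w‖ ^ 2 := by
  have hw : ‖w‖ ^ 2 = ∑ i, c i * ‖w‖ ^ 2 := by rw [← Finset.sum_mul, hc, one_mul]
  rw [hw, sum_inner, Finset.mul_sum, ← Finset.sum_sub_distrib, ← Finset.sum_add_distrib]
  refine Finset.sum_congr rfl fun i _ => ?_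
  rw [norm_sub_sq_real, real_inner_smul_left]
  ring

theorem hasGradientAt_const_mul_norm_sq {E : Type*} [NormedAddCommGroup E]
    [InnerProductSpace ℝ E] [CompleteSpace E] (a : ℝ) (u : E) :
    HasGradientAt (fun v : E => a * ‖v‖ ^ 2) ((2 * a) • u) u := by
  rw [hasGradientAt_iff_hasFDerivAt]
  refine ((hasStrictFDerivAt_norm_sq u).hasFDerivAt.const_mul a).congr_fderiv ?_
  ext v
  simp
  ring


/-- When exactly one barycentric coordinate (`ℓ 0`) is positive and the others are
nonpositive, `w = x 0`, the improved bound equals `(ν/2)(‖x‖² − Σ ℓᵢ‖xᵢ‖²)`, and the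
function `f(u) = −(ν/2)‖u‖²` belongs to `C¹,¹_ν` and attains this bound. -/
theorem stmt_6 (n : ℕ) (ν : ℝ) (hν : 0 < ν)
    (x : Fin (n + 1) → EuclideanSpace ℝ (Fin n)) (hx : AffineIndependent ℝ x)
    (p : EuclideanSpace ℝ (Fin n)) (ℓ : Fin (n + 1) → ℝ)
    (hsum : ∑ i, ℓ i = 1) (hbary : ∑ i, ℓ i • x i = p)
    (h0 : 0 < ℓ 0) (hneg : ∀ i, i ≠ 0 → ℓ i ≤ 0)
    (w : EuclideanSpace ℝ (Fin n))
    (hw : w = (1 + ∑ i, |ℓ i|)⁻¹ • (p + ∑ i, |ℓ i| • x i))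
    (f : EuclideanSpace ℝ (Fin n) → ℝ)
    (hf : ∀ u, f u = -(ν / 2) * ‖u‖ ^ 2)
    (fhat : EuclideanSpace ℝ (Fin n) →ᵃ[ℝ] ℝ)
    (hfhat : ∀ i, fhat (x i) = f (x i)) :
    w = x 0 ∧
    ν / 2 * (‖p - w‖ ^ 2 + ∑ i, |ℓ i| * ‖x i - w‖ ^ 2)
      = ν / 2 * (‖p‖ ^ 2 - ∑ i, ℓ i * ‖x i‖ ^ 2) ∧
    Differentiable ℝ f ∧
    (∀ u v, ‖gradient f u - gradient f v‖ ≤ ν * ‖u - v‖) ∧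
    fhat p - f p = ν / 2 * (‖p‖ ^ 2 - ∑ i, ℓ i * ‖x i‖ ^ 2) := by
  have habs : ∑ i, |ℓ i| = 2 * ℓ 0 - 1 := by
    have h := fun i => abs_smul_eq_of_nonpos_of_ne ℓ 0 h0 hneg (fun _ => (1 : ℝ)) i
    simp only [smul_eq_mul, mul_one] at h
    simp [h, hsum]
  have hw0 : w = x 0 := by
    rw [hw, Finset.sum_congr rfl fun i _ => abs_smul_eq_of_nonpos_of_ne ℓ 0 h0 hneg x i,
      Finset.sum_sub_distrib, hbary, habs]
    simp only [Finset.sum_ite_eq', Finset.mem_univ, if_true, add_sub_cancel]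
    exact inv_smul_smul₀ (by positivity) _
  have hgrad : ∀ u, HasGradientAt f ((-ν) • u) u := by
    intro u
    rw [funext hf, show -ν = 2 * (-(ν / 2)) by ring]
    exact hasGradientAt_const_mul_norm_sq _ u
  refine ⟨hw0, ?_, fun u => (hgrad u).differentiableAt, fun u v => ?_, ?_⟩
  · have h := fun i => abs_smul_eq_of_nonpos_of_ne ℓ 0 h0 hneg (fun i => ‖x i - x 0‖ ^ 2) i
    simp only [smul_eq_mul, sub_self, norm_zero, ne_eq, OfNat.ofNat_ne_zero, not_false_eq_true,
      zero_pow, mul_zero, ite_self, zero_sub] at h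
    rw [hw0, Finset.sum_congr rfl fun i _ => h i, Finset.sum_neg_distrib,
      sum_mul_norm_sub_sq_of_sum_eq_one ℓ x hsum, hbary, norm_sub_sq_real]
    ring
  · rw [(hgrad u).gradient, (hgrad v).gradient, ← smul_sub, norm_smul, norm_neg,
      Real.norm_of_nonneg hν.le]
  · have h := fhat.map_sum_smul_of_sum_eq_one x ℓ hsum
    rw [hbary] at h
    simp only [h, hfhat, hf, smul_eq_mul, mul_left_comm _ (-(ν / 2)), ← Finset.mul_sum]
    ring
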